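/- Let L be a complex Lie algebra admitting elements f₁, f₂ that are linearly independent, span L, and satisfy ⁅f₁, f₂⁆ = f₂ (the two-dimensional non-abelian complex Lie algebra). Then every ℂ-linear map P : L → L satisfying P ∘ P = P and P⁅x, y⁆ = ⁅P x, y⁆ for all x, y ∈ L is either the zero map or the identity. -/

import Mathlib

/-- In the two-dimensional non-abelian complex Lie algebra (with basis `f₁, f₂` and
`⁅f₁, f₂⁆ = f₂`), every ℂ-linear idempotent `P` satisfying `P ⁅x, y⁆ = ⁅P x, y⁆`
is either the zero map or the identity. -/
theorem stmt_10 (L : Type*) [LieRing L] [LieAlgebra ℂ L]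
    (f₁ f₂ : L) (hli : LinearIndependent ℂ ![f₁, f₂])
    (hspan : Submodule.span ℂ {f₁, f₂} = ⊤)
    (hbr : ⁅f₁, f₂⁆ = f₂)
    (P : L →ₗ[ℂ] L) (hP : P ∘ₗ P = P)
    (hcomm : ∀ x y : L, P ⁅x, y⁆ = ⁅P x, y⁆) :
    P = 0 ∨ P = LinearMap.id := by
  have hf₂ : f₂ ≠ 0 := hli.ne_zero 1
  have hbr' : ⁅f₂, f₁⁆ = -f₂ := by rw [← lie_skew, hbr]
  obtain ⟨a, b, hab⟩ := Submodule.mem_span_pair.mp (hspan ▸ Submodule.mem_top : P f₁ ∈ _)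
  have hb : b = 0 := by
    have h := hcomm f₁ f₁
    rw [← hab] at h
    simpa [hbr', hf₂] using h
  subst hb
  have h₁ : P f₁ = a • f₁ := by simpa using hab.symm
  have h₂ : P f₂ = a • f₂ := by
    have h := hcomm f₁ f₂
    rwa [h₁, smul_lie, hbr] at h
  have hPa : P = a • LinearMap.id := by
    refine LinearMap.ext_on hspan ?_
    rintro x (rfl | rfl)
    · simpa using h₁
    · simpa using h₂
  have ha : a * a = a := by
    have h := LinearMap.congr_fun hP f₂
    rw [LinearMap.comp_apply, h₂, map_smul, h₂, smul_smul] at h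
    exact smul_left_injective ℂ hf₂ h
  rcases IsIdempotentElem.iff_eq_zero_or_one.mp ha with rfl | rfl
  · exact Or.inl (by simpa using hPa)
  · exact Or.inr (by simpa using hPa)
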